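/- The number of maximal-shape type (B_n,n) Le-diagrams equals twice the number of preference functions of length n (twice the n-th ordered Bell number). More precisely, the set of staircase-shape type (B_n,n) Le-diagrams whose bottom (corner) box contains a + is in bijection with preference functions of length n, and the bottom box imposes no constraint, so the full count is double. -/

import Mathlib

/-- A preference function of length `n` (encoded as a function `ℕ → ℕ` vanishing off
`{1, …, n}`): for some `k ≤ n`, all of `1, …, k` occur and nothing larger occurs. -/
def IsPref (n : ℕ) (p : ℕ → ℕ) : Prop :=
  (∀ i, i ∉ Finset.Icc 1 n → p i = 0) ∧
  ∃ k, k ≤ n ∧ (∀ i ∈ Finset.Icc 1 n, 1 ≤ p i ∧ p i ≤ k) ∧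
    ∀ j ∈ Finset.Icc 1 k, ∃ i ∈ Finset.Icc 1 n, p i = j

/-- A type `(B_n, n)` Le-diagram of maximal (staircase) shape.  Boxes `(i, j)` with
`i < n`, `j < n - i`; row `0` is the longest row, row `n-1` is the single-box bottom row,
and the diagonal box of row `i` is `(i, n-1-i)`; `true` = `+`.  The Le-conditions:
(1) if a `0` lies above a `+` in the same column, all boxes to its left in its row are
`0`'s; (2) if a diagonal box contains a `0`, all boxes to its left in its row are `0`'s. -/
def IsMaxLeB (n : ℕ) (D : ℕ → ℕ → Bool) : Prop :=
  (∀ i j, ¬ (i < n ∧ j < n - i) → D i j = false) ∧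
  (∀ i j, i < n → j < n - i → D i j = false →
    (∃ i', i < i' ∧ i' < n ∧ j < n - i' ∧ D i' j = true) →
    ∀ j', j' < j → D i j' = false) ∧
  (∀ i, i < n → D i (n - i - 1) = false → ∀ j', j' < n - i - 1 → D i j' = false)


/-- The number `k! S(n,k)` of surjections. -/
def surjNum (n k : ℕ) : ℕ := k.factorial * Nat.stirlingSecond n k

lemma surjNum_succ_succ (n k : ℕ) :
    surjNum (n+1) (k+1) = (k+1) * (surjNum n (k+1) + surjNum n k) := by
  simp only [surjNum, Nat.stirlingSecond_succ_succ, Nat.factorial_succ]; ring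

lemma sum_choose_surjNum (n k : ℕ) :
    ∑ j ∈ Finset.range (k+1), k.choose j * surjNum n j = k ^ n := by
  induction n with
  | zero =>
    rw [Finset.sum_range_succ']
    simp [surjNum, Nat.stirlingSecond]
  | succ n ih =>
    rw [Finset.sum_range_succ']
    have h0 : surjNum (n+1) 0 = 0 := by simp [surjNum]
    rw [h0, mul_zero, add_zero, pow_succ, ← ih, Finset.sum_mul]
    have e1 : ∑ j ∈ Finset.range k, k.choose (j+1) * surjNum (n+1) (j+1)
        = ∑ j ∈ Finset.range k, k.choose (j+1) * (j+1) * surjNum n (j+1)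
          + ∑ j ∈ Finset.range k, k.choose j * (k - j) * surjNum n j := by
      rw [← Finset.sum_add_distrib]
      refine Finset.sum_congr rfl fun j _ => ?_
      rw [surjNum_succ_succ, ← Nat.choose_succ_right_eq]; ring
    have e2 : ∑ j ∈ Finset.range k, k.choose (j+1) * (j+1) * surjNum n (j+1)
        = ∑ j ∈ Finset.range (k+1), k.choose j * j * surjNum n j := by
      rw [Finset.sum_range_succ']; simp
    have e3 : ∑ j ∈ Finset.range k, k.choose j * (k - j) * surjNum n j
        = ∑ j ∈ Finset.range (k+1), k.choose j * (k - j) * surjNum n j := by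
      rw [Finset.sum_range_succ]; simp
    rw [e1, e2, e3, ← Finset.sum_add_distrib]
    refine Finset.sum_congr rfl fun j hj => ?_
    have : j ≤ k := by simpa [Nat.lt_succ_iff] using hj
    obtain ⟨d, rfl⟩ := Nat.exists_eq_add_of_le this
    simp only [Nat.add_sub_cancel_left]; ring

/-- functions with image exactly `J` -/
lemma card_image_eq (n : ℕ) (J : Finset ℕ) :
    ((Fintype.piFinset (fun _ : Fin n => J)).filter
      (fun f => Finset.univ.image f = J)).card = surjNum n J.card := by
  induction J using Finset.strongInduction with
  | H J ih =>
  have h1 : (Fintype.piFinset (fun _ : Fin n => J)).card =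
      ∑ K ∈ J.powerset, ((Fintype.piFinset (fun _ : Fin n => J)).filter
      (fun f => Finset.univ.image f = K)).card := by
    apply Finset.card_eq_sum_card_fiberwise
    intro f hf
    simp only [Finset.coe_powerset, Set.mem_preimage, Set.mem_powerset_iff, Finset.coe_subset]
    intro y hy
    simp only [Finset.mem_coe, Fintype.mem_piFinset] at hf
    simp only [Finset.mem_image, Finset.mem_univ, true_and] at hy
    obtain ⟨a, rfl⟩ := hy
    exact hf a
  have h2 : ∀ K ∈ J.powerset, ((Fintype.piFinset (fun _ : Fin n => J)).filter
      (fun f => Finset.univ.image f = K)) = ((Fintype.piFinset (fun _ : Fin n => K)).filter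
      (fun f => Finset.univ.image f = K)) := by
    intro K hK
    rw [Finset.mem_powerset] at hK
    ext f
    simp only [Finset.mem_filter, Fintype.mem_piFinset]
    constructor
    · rintro ⟨_, rfl⟩
      exact ⟨fun a => by simp, rfl⟩
    · rintro ⟨h, h'⟩
      exact ⟨fun a => hK (h a), h'⟩
  rw [Finset.sum_congr rfl (fun K hK => by rw [h2 K hK])] at h1
  have h3 : ∑ K ∈ J.powerset, surjNum n K.card = J.card ^ n := by
    rw [Finset.sum_powerset_apply_card (fun j => surjNum n j), ← sum_choose_surjNum]
    simp
  rw [Fintype.card_piFinset_const, ← h3] at h1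
  have hJ := Finset.mem_powerset_self J
  rw [← Finset.add_sum_erase _ _ hJ, ← Finset.add_sum_erase _ _ hJ] at h1
  have h4 : ∑ K ∈ J.powerset.erase J, ((Fintype.piFinset (fun _ : Fin n => K)).filter
      (fun f => Finset.univ.image f = K)).card = ∑ K ∈ J.powerset.erase J, surjNum n K.card := by
    refine Finset.sum_congr rfl fun K hK => ih K ?_
    rw [Finset.mem_erase, Finset.mem_powerset] at hK
    exact Finset.ssubset_iff_subset_ne.2 ⟨hK.2, hK.1⟩
  omega

/-- ordered Bell numbers -/
def fub (n : ℕ) : ℕ := ∑ k ∈ Finset.range (n+1), surjNum n k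

/-- preference functions as a finset of functions on `Fin n`. -/
def prefSet (n : ℕ) : Finset (Fin n → ℕ) :=
  (Finset.range (n+1)).biUnion fun k =>
    (Fintype.piFinset (fun _ : Fin n => Finset.Icc 1 k)).filter
      (fun f => Finset.univ.image f = Finset.Icc 1 k)

lemma card_prefSet (n : ℕ) : (prefSet n).card = fub n := by
  unfold prefSet fub
  rw [Finset.card_biUnion]
  · refine Finset.sum_congr rfl fun k _ => ?_
    rw [card_image_eq]; simp
  · intro a _ b _ hab
    refine Finset.disjoint_left.2 ?_
    intro f hf hf'
    rw [Finset.mem_filter] at hf hf'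
    have := congrArg Finset.card (hf.2.symm.trans hf'.2)
    simp at this
    exact hab this

lemma mem_prefSet (n : ℕ) (f : Fin n → ℕ) : f ∈ prefSet n ↔
    ∃ k ≤ n, (∀ a, 1 ≤ f a ∧ f a ≤ k) ∧ ∀ j, 1 ≤ j → j ≤ k → ∃ a, f a = j := by
  simp only [prefSet, Finset.mem_biUnion, Finset.mem_range, Finset.mem_filter,
    Fintype.mem_piFinset, Finset.mem_Icc, Nat.lt_succ_iff]
  refine exists_congr fun k => and_congr_right fun _ => and_congr_right fun h => ?_
  constructor
  · intro h' j h1 h2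
    have : j ∈ Finset.univ.image f := by rw [h']; simp [h1, h2]
    simpa using this
  · intro h'
    ext j
    simp only [Finset.mem_image, Finset.mem_univ, true_and, Finset.mem_Icc]
    constructor
    · rintro ⟨a, rfl⟩; exact h a
    · rintro ⟨h1, h2⟩; exact h' j h1 h2

/-- preference functions on `ℕ` versus on `Fin n`. -/
def prefEquiv (n : ℕ) : {p : ℕ → ℕ // IsPref n p} ≃ {f // f ∈ prefSet n} where
  toFun p := ⟨fun a => p.1 (a.1 + 1), by
    obtain ⟨p, h0, k, hk, h1, h2⟩ := p
    rw [mem_prefSet]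
    refine ⟨k, hk, fun a => h1 _ (by simp only [Finset.mem_Icc]; omega), fun j hj hj' => ?_⟩
    obtain ⟨i, hi, h⟩ := h2 j (by simp only [Finset.mem_Icc]; omega)
    rw [Finset.mem_Icc] at hi
    refine ⟨⟨i - 1, by omega⟩, ?_⟩
    simp only [show i - 1 + 1 = i by omega, h]⟩
  invFun f := ⟨fun i => if h : 1 ≤ i ∧ i ≤ n then f.1 ⟨i - 1, by omega⟩ else 0, by
    obtain ⟨f, hf⟩ := f
    rw [mem_prefSet] at hf
    obtain ⟨k, hk, h1, h2⟩ := hf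
    refine ⟨fun i hi => dif_neg (by simpa only [Finset.mem_Icc] using hi), k, hk, ?_, ?_⟩
    · intro i hi
      rw [Finset.mem_Icc] at hi
      simp only [dif_pos hi]; exact h1 _
    · intro j hj
      rw [Finset.mem_Icc] at hj
      obtain ⟨a, ha⟩ := h2 j hj.1 hj.2
      refine ⟨a.1 + 1, by simp only [Finset.mem_Icc]; omega, ?_⟩
      have h : 1 ≤ a.1 + 1 ∧ a.1 + 1 ≤ n := by omega
      simp only [dif_pos h]; simpa using ha⟩
  left_inv := by
    rintro ⟨p, h0, h⟩
    apply Subtype.ext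
    funext i
    by_cases hi : 1 ≤ i ∧ i ≤ n
    · simp only [dif_pos hi, show i - 1 + 1 = i by omega]
    · simp only [dif_neg hi]
      exact (h0 i (by simpa only [Finset.mem_Icc] using hi)).symm
  right_inv := by
    rintro ⟨f, hf⟩
    apply Subtype.ext
    funext a
    have : 1 ≤ a.1 + 1 ∧ a.1 + 1 ≤ n := by omega
    simp only [dif_pos this, Nat.add_sub_cancel]

lemma card_pref (n : ℕ) : Nat.card {p : ℕ → ℕ // IsPref n p} = fub n := by
  rw [Nat.card_congr (prefEquiv n), Nat.card_eq_fintype_card, Fintype.card_coe, card_prefSet]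

/-- the row polynomial -/
def rowPoly (n x : ℕ) : ℕ :=
  ∑ k ∈ Finset.range (n+1), Nat.stirlingSecond (n+1) (k+1) * x.ascFactorial k

lemma rowPoly_succ (n x : ℕ) :
    rowPoly (n+1) x + x * rowPoly n x = 2 * x * rowPoly n (x+1) + rowPoly n x := by
  unfold rowPoly
  have e1 : ∑ k ∈ Finset.range (n+1+1), Nat.stirlingSecond (n+1+1) (k+1) * x.ascFactorial k
      = ∑ k ∈ Finset.range (n+1), (k+1) * Nat.stirlingSecond (n+1) (k+1) * x.ascFactorial k
       + ∑ k ∈ Finset.range (n+1), Nat.stirlingSecond (n+1) (k+1) * x.ascFactorial (k+1) := by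
    have a : ∑ k ∈ Finset.range (n+1), Nat.stirlingSecond (n+1) (k+1) * x.ascFactorial (k+1)
        = ∑ k ∈ Finset.range (n+1+1), Nat.stirlingSecond (n+1) k * x.ascFactorial k := by
      rw [Finset.sum_range_succ' _ (n+1)]; simp
    have b : ∑ k ∈ Finset.range (n+1), (k+1) * Nat.stirlingSecond (n+1) (k+1) * x.ascFactorial k
        = ∑ k ∈ Finset.range (n+1+1),
          (k+1) * Nat.stirlingSecond (n+1) (k+1) * x.ascFactorial k := by
      rw [Finset.sum_range_succ _ (n+1),
        Nat.stirlingSecond_eq_zero_of_lt (show n + 1 < n + 1 + 1 by omega)]; simp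
    rw [a, b, ← Finset.sum_add_distrib]
    refine Finset.sum_congr rfl fun k _ => ?_
    rw [Nat.stirlingSecond_succ_succ (n+1) k]; ring
  rw [e1, Finset.mul_sum, Finset.mul_sum, ← Finset.sum_add_distrib, ← Finset.sum_add_distrib,
    ← Finset.sum_add_distrib]
  refine Finset.sum_congr rfl fun k _ => ?_
  have h := Nat.succ_ascFactorial x k
  rw [Nat.succ_eq_add_one] at h
  have : 2 * x * (Nat.stirlingSecond (n+1) (k+1) * (x+1).ascFactorial k)
    = 2 * Nat.stirlingSecond (n+1) (k+1) * (x * (x+1).ascFactorial k) := by ring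
  rw [this, h, Nat.ascFactorial_succ]; ring

lemma rowPoly_one (n : ℕ) (hn : 1 ≤ n) : rowPoly n 1 = 2 * fub n := by
  unfold rowPoly fub
  have h : ∀ k ∈ Finset.range (n+1), Nat.stirlingSecond (n+1) (k+1) * (1:ℕ).ascFactorial k
      = surjNum n (k+1) + surjNum n k := by
    intro k _
    simp only [surjNum, Nat.one_ascFactorial, Nat.stirlingSecond_succ_succ, Nat.factorial_succ]
    ring
  rw [Finset.sum_congr rfl h, Finset.sum_add_distrib, two_mul]
  congr 1
  have h0 : surjNum n 0 = 0 := by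
    obtain ⟨m, rfl⟩ := Nat.exists_eq_add_of_le' hn
    simp [surjNum]
  have h1 : surjNum n (n+1) = 0 := by
    simp [surjNum, Nat.stirlingSecond_eq_zero_of_lt]
  rw [Finset.sum_range_succ, h1, Finset.sum_range_succ', h0]

/-- surviving unrestricted rows -/
def newU (U c : Finset ℕ) : Finset ℕ := U.filter fun i => i ∈ c ∨ ∀ i' ∈ c, i' ≤ i

lemma newU_insert_insert (a : ℕ) (U c : Finset ℕ) (ha : ∀ x ∈ U, a < x) (hc : c ⊆ U) :
    newU (insert a U) (insert a c) = insert a (newU U c) := by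
  ext i
  simp only [newU, Finset.mem_filter, Finset.mem_insert]
  grind

lemma newU_insert_of_nonempty (a : ℕ) (U c : Finset ℕ) (ha : ∀ x ∈ U, a < x) (hc : c ⊆ U)
    (h : c ≠ ∅) : newU (insert a U) c = newU U c := by
  obtain ⟨y, hy⟩ := Finset.nonempty_iff_ne_empty.2 h
  ext i
  simp only [newU, Finset.mem_filter, Finset.mem_insert]
  have := ha y (hc hy)
  grind

lemma newU_empty (U : Finset ℕ) : newU U ∅ = U := by simp [newU]

lemma fibre_sum (x : ℕ) (U : Finset ℕ) :
    ∑ c ∈ U.powerset, x ^ (newU U c).card + x * x ^ U.card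
      = x ^ U.card + x * (x + 1) ^ U.card := by
  induction U using Finset.induction_on_min with
  | empty => simp [newU]
  | insert a U ha ih =>
    have hau : a ∉ U := fun h => lt_irrefl _ (ha a h)
    rw [Finset.sum_powerset_insert hau, Finset.card_insert_of_notMem hau]
    have h1 : ∑ c ∈ U.powerset, x ^ (newU (insert a U) (insert a c)).card
        = x * ∑ c ∈ U.powerset, x ^ (newU U c).card := by
      rw [Finset.mul_sum]
      refine Finset.sum_congr rfl fun c hc => ?_
      rw [newU_insert_insert a U c ha (Finset.mem_powerset.1 hc),
        Finset.card_insert_of_notMem (show a ∉ newU U c from fun h => hau (Finset.mem_filter.1 h).1), pow_succ, mul_comm]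
    have h2 : ∑ c ∈ U.powerset, x ^ (newU (insert a U) c).card + x ^ U.card
        = ∑ c ∈ U.powerset, x ^ (newU U c).card + x ^ (U.card + 1) := by
      rw [← Finset.add_sum_erase _ _ (Finset.empty_mem_powerset U),
        ← Finset.add_sum_erase _ (fun c => x ^ (newU U c).card) (Finset.empty_mem_powerset U)]
      rw [newU_empty, newU_empty, Finset.card_insert_of_notMem hau]
      rw [Finset.sum_congr rfl (g := fun c => x ^ (newU U c).card)]
      · ring
      · intro c hc
        rw [Finset.mem_erase, Finset.mem_powerset] at hc
        rw [newU_insert_of_nonempty a U c ha hc.2 hc.1]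
    rw [h1]
    zify at *
    linear_combination h2 + (1 + (x:ℤ)) * ih

open Classical in
/-- The unrestricted rows of a diagram. -/
noncomputable def unr (n : ℕ) (D : ℕ → ℕ → Bool) : Finset ℕ :=
  (Finset.range n).filter fun i => D i (n - i - 1) = true ∧
    ∀ j, j < n - i → D i j = false → ∀ i', i < i' → D i' j = false

lemma mem_unr {n : ℕ} {D : ℕ → ℕ → Bool} {i : ℕ} : i ∈ unr n D ↔ i < n ∧
    D i (n - i - 1) = true ∧
    ∀ j, j < n - i → D i j = false → ∀ i', i < i' → D i' j = false := by
  simp [unr]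

/-- Add a column on the left. -/
def addCol (D : ℕ → ℕ → Bool) (c : Finset ℕ) : ℕ → ℕ → Bool := fun i j =>
  match j with
  | 0 => decide (i ∈ c)
  | j + 1 => D i j

lemma addCol_isMax {n : ℕ} {D : ℕ → ℕ → Bool} {c : Finset ℕ} (hD : IsMaxLeB n D)
    (hc : c ⊆ insert n (unr n D)) : IsMaxLeB (n+1) (addCol D c) := by
  obtain ⟨h1, h2, h3⟩ := hD
  have hc' : ∀ i ∈ c, i = n ∨ i ∈ unr n D := fun i hi => by simpa using hc hi
  refine ⟨?_, ?_, ?_⟩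
  · intro i j hij
    cases j with
    | zero =>
      have : i ∉ c := fun hi => by
        rcases hc' i hi with h | h
        · omega
        · rw [mem_unr] at h; omega
      simp [addCol, this]
    | succ j => exact h1 i j (by omega)
  · rintro i j hi hj h0 ⟨i', hi', hi'n, hj', ht⟩ j' hjj
    cases j with
    | zero => omega
    | succ j =>
      simp only [addCol] at h0 ht
      cases j' with
      | zero =>
        have : i ∉ c := fun hic => by
          rcases hc' i hic with h | h
          · omega
          · rw [mem_unr] at h
            have := h.2.2 j (by omega) h0 i' hi'
            simp [this] at ht
        simp [addCol, this]
      | succ j' => exact h2 i j (by omega) (by omega) h0 ⟨i', hi', by omega, by omega, ht⟩ j' (by omega)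
  · intro i hi h0 j' hj'
    rcases Nat.lt_or_ge i n with hin | hin
    · have e : n + 1 - i - 1 = (n - i - 1) + 1 := by omega
      rw [e] at h0
      simp only [addCol] at h0
      cases j' with
      | zero =>
        have : i ∉ c := fun hic => by
          rcases hc' i hic with h | h
          · omega
          · rw [mem_unr] at h
            simp [h.2.1] at h0
        simp [addCol, this]
      | succ j' => exact h3 i hin h0 j' (by omega)
    · omega

/-- remove the left column -/
def delCol (D : ℕ → ℕ → Bool) : ℕ → ℕ → Bool := fun i j => D i (j+1)

/-- the left column -/
def leftCol (n : ℕ) (D : ℕ → ℕ → Bool) : Finset ℕ :=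
  (Finset.range (n+1)).filter fun i => D i 0 = true

lemma delCol_isMax {n : ℕ} {D : ℕ → ℕ → Bool} (hD : IsMaxLeB (n+1) D) :
    IsMaxLeB n (delCol D) := by
  obtain ⟨h1, h2, h3⟩ := hD
  refine ⟨?_, ?_, ?_⟩
  · intro i j hij
    exact h1 i (j+1) (by omega)
  · rintro i j hi hj h0 ⟨i', hi', hi'n, hj', ht⟩ j' hjj
    exact h2 i (j+1) (by omega) (by omega) h0 ⟨i', hi', by omega, by omega, ht⟩ (j'+1) (by omega)
  · intro i hi h0 j' hj'
    refine h3 i (by omega) ?_ (j'+1) (by omega)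
    have e : n + 1 - i - 1 = (n - i - 1) + 1 := by omega
    rw [e]; exact h0

lemma leftCol_subset {n : ℕ} {D : ℕ → ℕ → Bool} (hD : IsMaxLeB (n+1) D) :
    leftCol n D ⊆ insert n (unr n (delCol D)) := by
  obtain ⟨h1, h2, h3⟩ := hD
  intro i hi
  simp only [leftCol, Finset.mem_filter, Finset.mem_range] at hi
  rw [Finset.mem_insert, mem_unr]
  rcases Nat.lt_or_ge i n with hin | hin
  · refine Or.inr ⟨hin, ?_, ?_⟩
    · by_contra h
      have e : n + 1 - i - 1 = (n - i - 1) + 1 := by omega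
      have := h3 i (by omega) (by rw [e]; simpa [delCol] using h) 0 (by omega)
      simp [this] at hi
    · intro j hj h0 i' hi'
      by_contra h
      have ht : D i' (j+1) = true := by simpa [delCol] using h
      have hb : i' < n + 1 ∧ j + 1 < n + 1 - i' := by
        by_contra hb
        simp [h1 i' (j+1) hb] at ht
      have := h2 i (j+1) (by omega) (by omega) h0 ⟨i', hi', hb.1, hb.2, ht⟩ 0 (by omega)
      simp [this] at hi
  · left; omega

/-- The column decomposition. -/
noncomputable def colEquiv (n : ℕ) : {D : ℕ → ℕ → Bool // IsMaxLeB (n+1) D} ≃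
    Σ D : {D : ℕ → ℕ → Bool // IsMaxLeB n D}, {c // c ∈ (insert n (unr n D.1)).powerset} where
  toFun D := ⟨⟨delCol D.1, delCol_isMax D.2⟩,
    ⟨leftCol n D.1, Finset.mem_powerset.2 (leftCol_subset D.2)⟩⟩
  invFun s := ⟨addCol s.1.1 s.2.1, addCol_isMax s.1.2 (Finset.mem_powerset.1 s.2.2)⟩
  left_inv := by
    rintro ⟨D, hD⟩
    apply Subtype.ext
    funext i j
    cases j with
    | zero =>
      have := hD.1 i 0
      by_cases hi : i < n + 1
      · simp [addCol, leftCol, hi]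
      · simp [addCol, leftCol, hi, this (by omega)]
    | succ j => rfl
  right_inv := by
    rintro ⟨⟨D, hD⟩, ⟨c, hc⟩⟩
    have hl : leftCol n (addCol D c) = c := by
      ext i
      simp only [leftCol, addCol, Finset.mem_filter, Finset.mem_range, decide_eq_true_eq,
        and_iff_right_iff_imp]
      intro hi
      have := Finset.mem_powerset.1 hc hi
      rw [Finset.mem_insert, mem_unr] at this
      omega
    have hd : delCol (addCol D c) = D := rfl
    simp only [hl]
    rfl

lemma unr_addCol {n : ℕ} {D : ℕ → ℕ → Bool} {c : Finset ℕ}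
    (hD : IsMaxLeB n D) (hc : c ⊆ insert n (unr n D)) :
    unr (n+1) (addCol D c) = if n ∈ c then c else newU (unr n D) c := by
  have hle : ∀ i ∈ c, i ≤ n := fun i hi => by
    have := hc hi
    rw [Finset.mem_insert, mem_unr] at this
    omega
  have key : ∀ i, i ∈ unr (n+1) (addCol D c) ↔ (i = n ∧ n ∈ c) ∨
      (i ∈ unr n D ∧ (i ∉ c → ∀ i', i < i' → i' ∉ c)) := by
    intro i
    rw [mem_unr, mem_unr]
    rcases lt_trichotomy i n with hin | hin | hin
    · have e : n + 1 - i - 1 = (n - i - 1) + 1 := by omega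
      rw [e]
      simp only [addCol]
      constructor
      · rintro ⟨_, h1, h2⟩
        refine Or.inr ⟨⟨hin, h1, fun j hj h0 i' hi' => h2 (j+1) (by omega) h0 i' hi'⟩, ?_⟩
        intro hic i' hi'
        simpa using h2 0 (by omega) (by simpa using hic) i' hi'
      · rintro (h | ⟨⟨_, h1, h2⟩, h3⟩)
        · omega
        · refine ⟨by omega, h1, fun j hj h0 i' hi' => ?_⟩
          cases j with
          | zero => simpa using h3 (by simpa using h0) i' hi'
          | succ j => exact h2 j (by omega) h0 i' hi'
    · subst hin
      have e : i + 1 - i - 1 = 0 := by omega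
      rw [e]
      simp only [addCol, decide_eq_true_eq]
      constructor
      · rintro ⟨_, h, _⟩; exact Or.inl ⟨trivial, h⟩
      · rintro (h | h)
        · refine ⟨by omega, h.2, fun j hj h0 i' hi' => ?_⟩
          have : j = 0 := by omega
          subst this
          simp [h.2] at h0
        · omega
    · constructor
      · rintro ⟨h, _⟩; omega
      · rintro (h | h) <;> omega
  ext i
  rw [key]
  split_ifs with hn
  · constructor
    · rintro (h | ⟨h, h'⟩)
      · rw [h.1]; exact hn
      · by_contra hic
        exact h' hic n (mem_unr.1 h).1 hn
    · intro hi
      have := hc hi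
      rw [Finset.mem_insert] at this
      rcases this with h | h
      · exact Or.inl ⟨h, hn⟩
      · exact Or.inr ⟨h, fun h' => absurd hi h'⟩
  · simp only [hn, and_false, false_or, newU, Finset.mem_filter]
    refine and_congr_right fun _ => ?_
    grind

lemma fibre_sum_full {n : ℕ} {D : ℕ → ℕ → Bool} (hD : IsMaxLeB n D) (x : ℕ) :
    ∑ c ∈ (insert n (unr n D)).powerset, x ^ (unr (n+1) (addCol D c)).card
      + x * x ^ (unr n D).card
      = 2 * x * (x + 1) ^ (unr n D).card + x ^ (unr n D).card := by
  have hn : n ∉ unr n D := fun h => by rw [mem_unr] at h; omega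
  rw [Finset.sum_powerset_insert hn]
  have h1 : ∑ c ∈ (unr n D).powerset, x ^ (unr (n+1) (addCol D c)).card
      = ∑ c ∈ (unr n D).powerset, x ^ (newU (unr n D) c).card := by
    refine Finset.sum_congr rfl fun c hc => ?_
    rw [Finset.mem_powerset] at hc
    rw [unr_addCol hD (hc.trans (Finset.subset_insert _ _)), if_neg (fun h => hn (hc h))]
  have h2 : ∑ c ∈ (unr n D).powerset, x ^ (unr (n+1) (addCol D (insert n c))).card
      = x * (x + 1) ^ (unr n D).card := by
    have := Finset.sum_pow_mul_eq_add_pow x 1 (unr n D)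
    rw [← this, Finset.mul_sum]
    refine Finset.sum_congr rfl fun c hc => ?_
    rw [Finset.mem_powerset] at hc
    rw [unr_addCol hD (Finset.insert_subset_insert _ hc), if_pos (Finset.mem_insert_self _ _),
      Finset.card_insert_of_notMem (fun h => hn (hc h)), one_pow, mul_one, pow_succ, mul_comm]
  have h3 := fibre_sum x (unr n D)
  rw [h1, h2]
  linarith

instance finMax (n : ℕ) : Finite {D : ℕ → ℕ → Bool // IsMaxLeB n D} := by
  induction n with
  | zero =>
    have : Subsingleton {D : ℕ → ℕ → Bool // IsMaxLeB 0 D} := by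
      refine ⟨fun a b => Subtype.ext ?_⟩
      funext i j
      rw [a.2.1 i j (by omega), b.2.1 i j (by omega)]
    infer_instance
  | succ n ih => exact Finite.of_equiv _ (colEquiv n).symm

noncomputable instance fintypeMax (n : ℕ) : Fintype {D : ℕ → ℕ → Bool // IsMaxLeB n D} :=
  Fintype.ofFinite _

lemma sum_unr (n x : ℕ) :
    ∑ D : {D : ℕ → ℕ → Bool // IsMaxLeB n D}, x ^ (unr n D.1).card = rowPoly n x := by
  induction n generalizing x with
  | zero =>
    have h : IsMaxLeB 0 (fun _ _ => false) := by
      refine ⟨fun _ _ _ => rfl, fun i j hi => by omega, fun i hi => by omega⟩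
    have : ∀ D : {D : ℕ → ℕ → Bool // IsMaxLeB 0 D}, D = ⟨_, h⟩ := by
      intro a
      apply Subtype.ext
      funext i j
      rw [a.2.1 i j (by omega)]
    rw [Fintype.sum_eq_single ⟨_, h⟩ (fun D hD => absurd (this D) hD)]
    simp [unr, rowPoly, Nat.stirlingSecond]
  | succ n ih =>
    have h1 : ∑ D : {D : ℕ → ℕ → Bool // IsMaxLeB (n+1) D}, x ^ (unr (n+1) D.1).card
        = ∑ D : {D : ℕ → ℕ → Bool // IsMaxLeB n D},
          ∑ c ∈ (insert n (unr n D.1)).powerset, x ^ (unr (n+1) (addCol D.1 c)).card := by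
      rw [← Equiv.sum_comp (colEquiv n).symm, Fintype.sum_sigma]
      refine Finset.sum_congr rfl fun D _ => ?_
      exact Finset.sum_coe_sort _ (fun c => x ^ (unr (n+1) (addCol D.1 c)).card)
    have h2 : ∑ D : {D : ℕ → ℕ → Bool // IsMaxLeB (n+1) D}, x ^ (unr (n+1) D.1).card
        + x * rowPoly n x = 2 * x * rowPoly n (x+1) + rowPoly n x := by
      rw [h1, ← ih x, ← ih (x+1), Finset.mul_sum, Finset.mul_sum, ← Finset.sum_add_distrib,
        ← Finset.sum_add_distrib]
      exact Finset.sum_congr rfl fun D _ => fibre_sum_full D.2 x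
    have := rowPoly_succ n x
    omega

lemma card_max (n : ℕ) (hn : 1 ≤ n) :
    Nat.card {D : ℕ → ℕ → Bool // IsMaxLeB n D} = 2 * fub n := by
  rw [← rowPoly_one n hn, ← sum_unr n 1, Nat.card_eq_fintype_card]
  simp

/-- flip the corner box -/
def flipC (n : ℕ) (D : ℕ → ℕ → Bool) : ℕ → ℕ → Bool := fun i j =>
  if i = n - 1 ∧ j = 0 then !(D i j) else D i j

lemma flipC_flipC (n : ℕ) (D : ℕ → ℕ → Bool) : flipC n (flipC n D) = D := by
  funext i j
  unfold flipC
  split_ifs <;> simp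

lemma flipC_isMax {n : ℕ} (hn : 1 ≤ n) {D : ℕ → ℕ → Bool} (hD : IsMaxLeB n D) :
    IsMaxLeB n (flipC n D) := by
  obtain ⟨h1, h2, h3⟩ := hD
  have ne : ∀ i j, ¬ (i = n - 1 ∧ j = 0) → flipC n D i j = D i j := fun i j h => if_neg h
  refine ⟨?_, ?_, ?_⟩
  · intro i j hij
    rw [ne i j (by omega)]; exact h1 i j hij
  · rintro i j hi hj h0 ⟨i', hi', hi'n, hj', ht⟩ j' hjj
    rw [ne _ _ (by omega)] at h0 ht ⊢
    exact h2 i j hi hj h0 ⟨i', hi', hi'n, hj', ht⟩ j' hjj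
  · intro i hi h0 j' hj'
    rw [ne _ _ (by omega)] at h0 ⊢
    exact h3 i hi h0 j' hj'

lemma card_corner (n : ℕ) (hn : 1 ≤ n) :
    Nat.card {D : ℕ → ℕ → Bool // IsMaxLeB n D} =
      2 * Nat.card {D : ℕ → ℕ → Bool // IsMaxLeB n D ∧ D (n - 1) 0 = true} := by
  have e : {D : ℕ → ℕ → Bool // IsMaxLeB n D} ≃
      {D : ℕ → ℕ → Bool // IsMaxLeB n D ∧ D (n - 1) 0 = true} × Bool :=
    { toFun := fun D => (⟨if D.1 (n-1) 0 = true then D.1 else flipC n D.1, by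
          split_ifs with h
          · exact ⟨D.2, h⟩
          · exact ⟨flipC_isMax hn D.2, by simpa [flipC] using h⟩⟩, D.1 (n-1) 0)
      invFun := fun s => ⟨if s.2 = true then s.1.1 else flipC n s.1.1, by
          split_ifs with h
          · exact s.1.2.1
          · exact flipC_isMax hn s.1.2.1⟩
      left_inv := by
        rintro ⟨D, hD⟩
        apply Subtype.ext
        by_cases h : D (n-1) 0 = true
        · simp [h]
        · simp [h, flipC_flipC]
      right_inv := by
        rintro ⟨⟨D, hD, h⟩, b⟩
        cases b
        · have : flipC n D (n-1) 0 = false := by simp [flipC, h]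
          simp [this, flipC_flipC]
        · simp [h] }
  rw [Nat.card_congr e, Nat.card_prod]
  simp [mul_comm]

/-- The staircase-shape type `(B_n, n)` Le-diagrams whose bottom (corner) box `(n-1, 0)`
contains a `+` are in bijection with the preference functions of length `n`; since the
bottom box imposes no constraint on any other box, the total number of maximal-shape type
`(B_n, n)` Le-diagrams is twice the number of preference functions of length `n`. -/
theorem maximal_typeB_Le_diagrams_vs_preference_functions (n : ℕ) (hn : 1 ≤ n) :
    Nonempty ({D : ℕ → ℕ → Bool // IsMaxLeB n D ∧ D (n - 1) 0 = true} ≃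
      {p : ℕ → ℕ // IsPref n p}) ∧
    Nat.card {D : ℕ → ℕ → Bool // IsMaxLeB n D} =
      2 * Nat.card {p : ℕ → ℕ // IsPref n p} := by
  refine ⟨?_, by rw [card_max n hn, card_pref]⟩
  have h1 := card_corner n hn
  rw [card_max n hn] at h1
  have : Finite {D : ℕ → ℕ → Bool // IsMaxLeB n D ∧ D (n - 1) 0 = true} :=
    Finite.of_injective
      (fun D => (⟨D.1, D.2.1⟩ : {D : ℕ → ℕ → Bool // IsMaxLeB n D}))
      (fun a b h => Subtype.ext (Subtype.mk.inj h))
  have : Finite {p : ℕ → ℕ // IsPref n p} := Finite.of_equiv _ (prefEquiv n).symm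
  refine (Finite.card_eq (α := {D : ℕ → ℕ → Bool // IsMaxLeB n D ∧ D (n - 1) 0 = true})).1 ?_
  rw [card_pref]
  omega
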